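/- Let h : [0,∞) → [0,∞) be Lebesgue integrable, let σ² : [0,∞) → ℝ be Borel measurable with 0 < c₁ ≤ σ²(u) ≤ c₂ < ∞ for all u and some constants c₁, c₂, and let β : [0,∞) → ℝ be bounded Borel measurable. Suppose that for every θ ≤ 0 and every x ≥ 0: ∫_{[0,x]} (β(u)+θ)·σ²(u)·e^{θu}·h(u) du = ∫_{[0,∞)} β(u)·σ²(u)·h(u) du − e^{θx}·∫_{(x,∞)} β(u)·σ²(u)·h(u) du. Then there exists a constant c ≥ 0 such that h(u) = (c/σ²(u))·exp(∫₀ᵘ β(v) dv) for Lebesgue-almost every u ≥ 0. -/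

import Mathlib

open MeasureTheory Set

/-- The exponential of an absolutely continuous function is absolutely continuous. -/
theorem AbsolutelyContinuousOnInterval.real_exp {f : ℝ → ℝ} {a b : ℝ}
    (hf : AbsolutelyContinuousOnInterval f a b) :
    AbsolutelyContinuousOnInterval (fun x ↦ Real.exp (f x)) a b := by
  obtain ⟨R, hR⟩ := hf.exists_bound
  obtain ⟨K, hK⟩ := (Real.contDiff_exp (n := 1)).contDiffOn.exists_lipschitzOnWith (by decide)
    (convex_closedBall (0 : ℝ) R) (isCompact_closedBall (0 : ℝ) R)
  have hmem : ∀ x ∈ uIcc a b, f x ∈ Metric.closedBall (0 : ℝ) R := fun x hx ↦ by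
    simpa using hR x hx
  rw [absolutelyContinuousOnInterval_iff] at hf ⊢
  intro ε hε
  obtain ⟨δ, hδ, hfδ⟩ := hf (ε / (K + 1)) (by positivity)
  refine ⟨δ, hδ, fun E hE hlen ↦ ?_⟩
  calc ∑ i ∈ Finset.range E.1, dist (Real.exp (f (E.2 i).1)) (Real.exp (f (E.2 i).2))
      ≤ ∑ i ∈ Finset.range E.1, K * dist (f (E.2 i).1) (f (E.2 i).2) :=
        Finset.sum_le_sum fun i hi ↦
          hK.dist_le_mul _ (hmem _ (hE.1 i hi).1) _ (hmem _ (hE.1 i hi).2)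
    _ = K * ∑ i ∈ Finset.range E.1, dist (f (E.2 i).1) (f (E.2 i).2) :=
        (Finset.mul_sum _ _ _).symm
    _ ≤ K * (ε / (K + 1)) := by gcongr; exact (hfδ E hE hlen).le
    _ < (K + 1) * (ε / (K + 1)) := by gcongr; linarith
    _ = ε := by field

/-- Solution of the linear Volterra equation `g t = c + ∫ s in a..t, b s * g s`,
assumed to hold only almost everywhere. -/
theorem const_add_integral_mul_eq_const_mul_exp_integral {b g : ℝ → ℝ} {a x c : ℝ}
    (hb : IntervalIntegrable b volume a x)
    (hbg : IntervalIntegrable (fun s ↦ b s * g s) volume a x)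
    (hg : ∀ᵐ t, t ∈ uIcc a x → g t = c + ∫ s in a..t, b s * g s) :
    c + ∫ s in a..x, b s * g s = c * Real.exp (∫ s in a..x, b s) := by
  have hac : AbsolutelyContinuousOnInterval
      (fun t ↦ (c + ∫ s in a..t, b s * g s) * Real.exp (-∫ s in a..t, b s)) a x := by
    have hconst : AbsolutelyContinuousOnInterval (fun _ ↦ c) a x :=
      contDiffOn_const.absolutelyContinuousOnInterval
    exact (hconst.fun_add
      (hbg.absolutelyContinuousOnInterval_intervalIntegral left_mem_uIcc)).fun_mul
      (hb.absolutelyContinuousOnInterval_intervalIntegral left_mem_uIcc).fun_neg.real_exp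
  obtain ⟨C, hC⟩ := hac.const_of_ae_hasDerivAt_zero <| by
    filter_upwards [hb.ae_hasDerivAt_integral, hbg.ae_hasDerivAt_integral, hg]
      with t hbt hbgt hgt ht
    refine (((hbgt ht a left_mem_uIcc).const_add c).mul
      (hbt ht a left_mem_uIcc).neg.exp).congr_deriv ?_
    rw [← hgt ht]
    ring
  have hend := (hC x right_mem_uIcc).trans (hC a left_mem_uIcc).symm
  simp only [intervalIntegral.integral_same, neg_zero, Real.exp_zero, add_zero, mul_one] at hend
  rwa [Real.exp_neg, ← div_eq_mul_inv, div_eq_iff (Real.exp_ne_zero _)] at hend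

/-- From the proof of Theorem 3.2 (`SDQ-main-1`): a nonnegative integrable density `h`
satisfying the limiting BAR identity must be of the closed form
`h(u) = (c/σ²(u)) exp(∫₀ᵘ β)` (a.e. on `[0,∞)`). -/
theorem stmt14
    (h σ2 β : ℝ → ℝ)
    (hh_nonneg : ∀ u : ℝ, 0 ≤ h u) (hh_int : IntegrableOn h (Ici 0))
    (hσ2_meas : Measurable σ2) (hβ_meas : Measurable β)
    (c₁ c₂ : ℝ) (hc₁ : 0 < c₁)
    (hσ2 : ∀ u : ℝ, 0 ≤ u → c₁ ≤ σ2 u ∧ σ2 u ≤ c₂)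
    (hβ_bdd : ∃ M : ℝ, ∀ u : ℝ, 0 ≤ u → |β u| ≤ M)
    (hBAR : ∀ θ : ℝ, θ ≤ 0 → ∀ x : ℝ, 0 ≤ x →
      ∫ u in Icc 0 x, (β u + θ) * σ2 u * Real.exp (θ * u) * h u
        = (∫ u in Ici 0, β u * σ2 u * h u)
          - Real.exp (θ * x) * ∫ u in Ioi x, β u * σ2 u * h u) :
    ∃ c : ℝ, 0 ≤ c ∧
      ∀ᵐ u ∂(volume : Measure ℝ), 0 ≤ u →
        h u = c / σ2 u * Real.exp (∫ v in Icc (0:ℝ) u, β v) := by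
  obtain ⟨M, hM⟩ := hβ_bdd
  have hg_int : IntegrableOn (fun u ↦ σ2 u * h u) (Ici 0) := by
    refine Integrable.bdd_mul (c := c₂) hh_int hσ2_meas.aestronglyMeasurable ?_
    filter_upwards [ae_restrict_mem measurableSet_Ici] with u hu
    rw [Real.norm_of_nonneg (hc₁.le.trans (hσ2 u hu).1)]
    exact (hσ2 u hu).2
  have hβg_int : IntegrableOn (fun u ↦ β u * (σ2 u * h u)) (Ici 0) := by
    refine Integrable.bdd_mul (c := M) hg_int hβ_meas.aestronglyMeasurable ?_
    filter_upwards [ae_restrict_mem measurableSet_Ici] with u hu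
    exact hM u hu
  have hβ_ii : ∀ x, 0 ≤ x → IntervalIntegrable β volume 0 x := fun x hx ↦ by
    rw [intervalIntegrable_iff_integrableOn_Ioc_of_le hx]
    refine Integrable.of_bound (C := M) hβ_meas.aestronglyMeasurable ?_
    filter_upwards [ae_restrict_mem measurableSet_Ioc] with u hu
    exact hM u hu.1.le
  have ii_of_int : ∀ f : ℝ → ℝ, IntegrableOn f (Ici 0) → ∀ x, 0 ≤ x →
      IntervalIntegrable f volume 0 x := fun f hf x hx ↦ by
    rw [intervalIntegrable_iff_integrableOn_Ioc_of_le hx]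
    exact hf.mono_set fun u hu ↦ hu.1.le
  have hβg_ii := ii_of_int _ hβg_int
  have hg_ii := ii_of_int _ hg_int
  set I := ∫ u in Ici 0, β u * (σ2 u * h u) with hI
  have hF : ∀ x, 0 ≤ x →
      ∫ u in 0..x, Real.exp (-u) * (β u * (σ2 u * h u) - σ2 u * h u)
        = I - Real.exp (-x) * (I - ∫ u in 0..x, β u * (σ2 u * h u)) := fun x hx ↦ by
    have hbar := hBAR (-1) (by norm_num) x hx
    have htail : ∫ u in Ioi x, β u * (σ2 u * h u)
        = I - ∫ u in 0..x, β u * (σ2 u * h u) := by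
      rw [hI, integral_Ici_eq_integral_Ioi, eq_sub_iff_add_eq',
        intervalIntegral.integral_interval_add_Ioi (hβg_int.mono_set Ioi_subset_Ici_self)
          (hβg_int.mono_set fun u hu ↦ hx.trans (mem_Ioi.1 hu).le)]
    simp only [mul_assoc (β _), neg_one_mul] at hbar
    rw [htail, ← hI, integral_Icc_eq_integral_Ioc, ← intervalIntegral.integral_of_le hx] at hbar
    rw [← hbar]
    exact intervalIntegral.integral_congr fun u _ ↦ by ring
  have hg_eq : ∀ x, 0 ≤ x → ∀ᵐ t, t ∈ uIcc 0 x →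
      σ2 t * h t = -I + ∫ s in 0..t, β s * (σ2 s * h s) := fun x hx ↦ by
    have hexp_ii : IntervalIntegrable
        (fun u ↦ Real.exp (-u) * (β u * (σ2 u * h u) - σ2 u * h u)) volume 0 x :=
      ((hβg_ii x hx).sub (hg_ii x hx)).continuousOn_mul (by fun_prop)
    have hne : ∀ᵐ t : ℝ, t ≠ 0 := Measure.ae_ne volume 0
    filter_upwards [hexp_ii.ae_hasDerivAt_integral, (hβg_ii x hx).ae_hasDerivAt_integral, hne]
      with t hleft hright ht0 ht
    have htpos : 0 < t := lt_of_le_of_ne (uIcc_of_le hx ▸ ht : t ∈ Icc 0 x).1 ht0.symm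
    have hd := (((hasDerivAt_neg t).exp).mul
      ((hright ht 0 left_mem_uIcc).const_sub I)).const_sub I
    have heq := (hleft ht 0 left_mem_uIcc).unique <| hd.congr_of_eventuallyEq <| by
      filter_upwards [Ioi_mem_nhds htpos] with y hy using hF y (mem_Ioi.1 hy).le
    apply mul_left_cancel₀ (Real.exp_ne_zero (-t))
    linear_combination -heq
  have hmain : ∀ᵐ u, 0 ≤ u →
      h u = -I / σ2 u * Real.exp (∫ v in Icc (0:ℝ) u, β v) := by
    have hall : ∀ᵐ t, ∀ n : ℕ, t ∈ uIcc 0 (n : ℝ) →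
        σ2 t * h t = -I + ∫ s in 0..t, β s * (σ2 s * h s) :=
      ae_all_iff.2 fun n ↦ hg_eq n n.cast_nonneg
    filter_upwards [hall] with u hu hu0
    obtain ⟨n, hn⟩ := exists_nat_ge u
    have hval := hu n (by rw [uIcc_of_le (hu0.trans hn)]; exact ⟨hu0, hn⟩)
    rw [const_add_integral_mul_eq_const_mul_exp_integral (g := fun s ↦ σ2 s * h s)
      (hβ_ii u hu0) (hβg_ii u hu0) (hg_eq u hu0)] at hval
    rw [integral_Icc_eq_integral_Ioc, ← intervalIntegral.integral_of_le hu0, div_mul_eq_mul_div,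
      eq_div_iff (hc₁.trans_le (hσ2 u hu0).1).ne', mul_comm, hval]
  refine ⟨-I, ?_, hmain⟩
  by_contra! hneg
  have hempty : ∀ᵐ u : ℝ, u ∉ Ici (0 : ℝ) := by
    filter_upwards [hmain] with u hu hu0
    have hlt : -I / σ2 u * Real.exp (∫ v in Icc (0:ℝ) u, β v) < 0 :=
      mul_neg_of_neg_of_pos (div_neg_of_neg_of_pos hneg (hc₁.trans_le (hσ2 u hu0).1))
        (Real.exp_pos _)
    exact (hh_nonneg u).not_gt (hu hu0 ▸ hlt)
  simpa using measure_eq_zero_iff_ae_notMem.2 hempty
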